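/- arXiv:2601.13553 — 2 statements merged into one kernel-verified Lean document; each statement's English description precedes it below -/
import Mathlib

section
/- Let X be a compact metrizable space and let ℱ be a Markov map on (X,𝒜). Suppose there exists N ∈ ℕ such that for every n ∈ ℕ, every point of X belongs to at most N pieces of the level-n partition 𝒜^n. Then ℱ is topologically expanding if and only if for every decreasing sequence (A^{(n)})_{n ≥ 0} with A^{(n)} ∈ 𝒜^n and A^{(n+1)} ⊆ A^{(n)} for all n, the intersection ⋂_{n ≥ 0} A^{(n)} consists of exactly one point. -/
noncomputable section

open Set Topology Filter

/-- The set of break-points of an indexed family `A` of subsets of `X`: points that belong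
to two distinct members of the family. -/
def bkSet {X : Type*} {m : ℕ} (A : Fin m → Set X) : Set X :=
  {x | ∃ i j : Fin m, i ≠ j ∧ x ∈ A i ∧ x ∈ A j}

/-- A Markov map `ℱ = {f₁, …, f_m}` on a partition `𝒜 = {A₁, …, A_m}` of a topological
space `X`: the pieces are closed, connected, have pairwise finite intersections and cover `X`;
each `f i` restricted to `A i` is a homeomorphism onto its image; the image of each piece is a
union of pieces; and break-points of pieces are mapped to break-points. -/
structure MarkovSystem (X : Type*) [TopologicalSpace X] (m : ℕ) where
  A : Fin m → Set X
  f : Fin m → X → X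
  closed : ∀ i, IsClosed (A i)
  conn : ∀ i, IsConnected (A i)
  interFin : ∀ i j, i ≠ j → (A i ∩ A j).Finite
  cover : ⋃ i, A i = Set.univ
  emb : ∀ i, Topology.IsEmbedding ((A i).restrict (f i))
  markov : ∀ i, ∃ Js : Set (Fin m), f i '' A i = ⋃ j ∈ Js, A j
  bk_mapsTo : ∀ i, f i '' (A i ∩ bkSet A) ⊆ bkSet A

/-- The level-`n` partitions `𝒜ⁿ` of a Markov map: `𝒜⁰ = 𝒜`, and `𝒜ⁿ⁺¹` consists of the
sets `f_i⁻¹(A_w) = A_i ∩ f_i⁻¹(A_w)` for `A_w ∈ 𝒜ⁿ` with `A_w ⊆ f_i(A_i)`. -/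
def level {X : Type*} [TopologicalSpace X] {m : ℕ} (S : MarkovSystem X m) : ℕ → Set (Set X)
  | 0 => Set.range S.A
  | n + 1 => {B | ∃ i : Fin m, ∃ C ∈ level S n, C ⊆ S.f i '' S.A i ∧ B = S.A i ∩ S.f i ⁻¹' C}

/-- A Markov map is topologically expanding if for every `x ∈ X` the sets
`Int (⋃ {A_w ∈ 𝒜ⁿ : x ∈ A_w})`, `n ∈ ℕ`, form a neighborhood basis at `x`. -/
def TopExpanding {X : Type*} [TopologicalSpace X] {m : ℕ} (S : MarkovSystem X m) : Prop :=
  ∀ x : X, (𝓝 x).HasBasis (fun _ : ℕ => True)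
    (fun n => interior (⋃₀ {B | B ∈ level S n ∧ x ∈ B}))

namespace MarkovSystem

variable {X : Type*} [TopologicalSpace X] {m : ℕ} (S : MarkovSystem X m)

lemma isEmbedding_domRestrict (i : Fin m) : IsEmbedding ((S.A i).domRestrict (S.f i)) :=
  S.emb i

lemma injOn_f (i : Fin m) : InjOn (S.f i) (S.A i) :=
  injOn_iff_injective.2 (S.isEmbedding_domRestrict i).injective

lemma continuousOn_f (i : Fin m) : ContinuousOn (S.f i) (S.A i) :=
  continuousOn_iff_continuous_domRestrict.2 (S.isEmbedding_domRestrict i).continuous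

lemma finite_level (n : ℕ) : (level S n).Finite := by
  induction n with
  | zero => exact finite_range S.A
  | succ n ih =>
    refine (Finite.image2 (fun i C => S.A i ∩ S.f i ⁻¹' C) finite_univ ih).subset ?_
    rintro B ⟨i, C, hC, -, rfl⟩
    exact ⟨i, mem_univ i, C, hC, rfl⟩

lemma isClosed_of_mem_level {n : ℕ} {B : Set X} (hB : B ∈ level S n) : IsClosed B := by
  induction n generalizing B with
  | zero => obtain ⟨i, rfl⟩ := hB; exact S.closed i
  | succ n ih =>
    obtain ⟨i, C, hC, -, rfl⟩ := hB
    exact (S.continuousOn_f i).preimage_isClosed_of_isClosed (S.closed i) (ih hC)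

lemma isConnected_of_mem_level {n : ℕ} {B : Set X} (hB : B ∈ level S n) : IsConnected B := by
  induction n generalizing B with
  | zero => obtain ⟨i, rfl⟩ := hB; exact S.conn i
  | succ n ih =>
    obtain ⟨i, C, hC, hCi, rfl⟩ := hB
    have hrange : C ⊆ range ((S.A i).domRestrict (S.f i)) := by rwa [range_domRestrict]
    have hconn : IsConnected ((S.A i).domRestrict (S.f i) ⁻¹' C) := by
      refine ⟨?_, ?_⟩
      · obtain ⟨y, hy⟩ := (ih hC).nonempty
        obtain ⟨x, rfl⟩ := hrange hy
        exact ⟨x, hy⟩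
      · rw [← (S.isEmbedding_domRestrict i).isInducing.isPreconnected_image, image_preimage_eq_of_subset hrange]
        exact (ih hC).isPreconnected
    have := hconn.image Subtype.val continuous_subtype_val.continuousOn
    rwa [domRestrict_eq, preimage_comp, Subtype.image_preimage_coe] at this

lemma finite_inter_of_mem_level {n : ℕ} {B C : Set X} (hB : B ∈ level S n) (hC : C ∈ level S n)
    (hne : B ≠ C) : (B ∩ C).Finite := by
  induction n generalizing B C with
  | zero =>
    obtain ⟨i, rfl⟩ := hB
    obtain ⟨j, rfl⟩ := hC
    exact S.interFin i j fun h => hne (h ▸ rfl)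
  | succ n ih =>
    obtain ⟨i, B, hB, -, rfl⟩ := hB
    obtain ⟨j, C, hC, -, rfl⟩ := hC
    obtain rfl | hij := eq_or_ne i j
    · refine Finite.of_finite_image ((ih hB hC fun h => hne (h ▸ rfl)).subset ?_)
        ((S.injOn_f i).mono fun x hx => hx.1.1)
      rintro _ ⟨x, hx, rfl⟩
      exact ⟨hx.1.2, hx.2.2⟩
    · exact (S.interFin i j hij).subset fun x hx => ⟨hx.1.1, hx.2.1⟩

lemma exists_mem_level_subset (n : ℕ) {j : Fin m} {x : X} (hx : x ∈ S.A j) :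
    ∃ B ∈ level S n, x ∈ B ∧ B ⊆ S.A j := by
  induction n generalizing j x with
  | zero => exact ⟨S.A j, mem_range_self j, hx, Subset.rfl⟩
  | succ n ih =>
    obtain ⟨J, hJ⟩ := S.markov j
    have hfx : S.f j x ∈ ⋃ k ∈ J, S.A k := hJ ▸ mem_image_of_mem _ hx
    obtain ⟨k, hk, hxk⟩ := mem_iUnion₂.1 hfx
    obtain ⟨C, hC, hxC, hCk⟩ := ih hxk
    refine ⟨_, ⟨j, C, hC, ?_, rfl⟩, ⟨hx, hxC⟩, inter_subset_left⟩
    rw [hJ]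
    exact hCk.trans (subset_biUnion_of_mem (u := S.A) hk)

lemma exists_mem_level (n : ℕ) (x : X) : ∃ B ∈ level S n, x ∈ B := by
  have hx : x ∈ ⋃ i, S.A i := S.cover ▸ mem_univ x
  obtain ⟨i, hi⟩ := mem_iUnion.1 hx
  obtain ⟨B, hB, hxB, -⟩ := S.exists_mem_level_subset n hi
  exact ⟨B, hB, hxB⟩

lemma exists_subset_A_of_mem_level {n : ℕ} {B : Set X} (hB : B ∈ level S n) :
    ∃ i, B ⊆ S.A i := by
  cases n with
  | zero => obtain ⟨i, rfl⟩ := hB; exact ⟨i, Subset.rfl⟩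
  | succ n => obtain ⟨i, C, -, -, rfl⟩ := hB; exact ⟨i, inter_subset_left⟩

/-- A point avoiding all the level-`n` pieces that do not contain `x` lies in the interior of the
union of the level-`n` pieces that do. -/
lemma mem_interior_star {n : ℕ} {x y : X} (hy : ∀ B ∈ level S n, y ∈ B → x ∈ B) :
    y ∈ interior (⋃₀ {B | B ∈ level S n ∧ x ∈ B}) := by
  have hclosed : IsClosed (⋃₀ {B | B ∈ level S n ∧ x ∉ B}) := by
    rw [sUnion_eq_biUnion]
    exact ((S.finite_level n).subset fun B hB => hB.1).isClosed_biUnion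
      fun B hB => S.isClosed_of_mem_level hB.1
  refine mem_interior.2 ⟨_, ?_, hclosed.isOpen_compl, ?_⟩
  · intro z hz
    obtain ⟨B, hB, hzB⟩ := S.exists_mem_level n z
    exact ⟨B, ⟨hB, by_contra fun h => hz ⟨B, ⟨hB, h⟩, hzB⟩⟩, hzB⟩
  · rintro ⟨B, hB, hyB⟩
    exact hB.2 (hy B hB.1 hyB)

lemma nested_nonempty [CompactSpace X] {A : ℕ → Set X} (hA : ∀ n, A n ∈ level S n)
    (hmono : ∀ n, A (n + 1) ⊆ A n) : (⋂ n, A n).Nonempty :=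
  IsCompact.nonempty_iInter_of_sequence_nonempty_isCompact_isClosed A hmono
    (fun n => (S.isConnected_of_mem_level (hA n)).nonempty)
    (S.isClosed_of_mem_level (hA 0)).isCompact fun n => S.isClosed_of_mem_level (hA n)

section T1

variable [T1Space X]

lemma exists_mem_subset_A {n : ℕ} {B : Set X} (hB : B ∈ level S n) {J : Set (Fin m)}
    (hBJ : B ⊆ ⋃ j ∈ J, S.A j) : ∃ j ∈ J, B ⊆ S.A j := by
  have hconn := S.isConnected_of_mem_level hB
  obtain hsub | hnt := B.subsingleton_or_nontrivial
  · obtain ⟨x, hx⟩ := hconn.nonempty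
    obtain ⟨j, hj, hxj⟩ := mem_iUnion₂.1 (hBJ hx)
    exact ⟨j, hj, fun y hy => hsub hx hy ▸ hxj⟩
  · obtain ⟨i, hi⟩ := S.exists_subset_A_of_mem_level hB
    by_contra! h
    refine hconn.isPreconnected.infinite_of_nontrivial hnt ((J.toFinite.biUnion
      (t := fun j => B ∩ S.A j) fun j hj => ?_).subset ?_)
    · exact (S.interFin i j fun hij => h j hj (hij ▸ hi)).subset
        (inter_subset_inter_left _ hi)
    · intro x hx
      obtain ⟨j, hj, hxj⟩ := mem_iUnion₂.1 (hBJ hx)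
      exact mem_iUnion₂.2 ⟨j, hj, hx, hxj⟩

lemma exists_level_between {n : ℕ} {B : Set X} (hB : B ∈ level S (n + 1)) {j : Fin m}
    (hBj : B ⊆ S.A j) : ∃ C ∈ level S n, B ⊆ C ∧ C ⊆ S.A j := by
  induction n generalizing B j with
  | zero => exact ⟨S.A j, mem_range_self j, hBj, Subset.rfl⟩
  | succ n ih =>
    have hconn := S.isConnected_of_mem_level hB
    obtain hsub | hnt := B.subsingleton_or_nontrivial
    · obtain ⟨x, hx⟩ := hconn.nonempty
      obtain ⟨C, hC, hxC, hCj⟩ := S.exists_mem_level_subset (n + 1) (hBj hx)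
      exact ⟨C, hC, fun y hy => hsub hx hy ▸ hxC, hCj⟩
    · obtain ⟨i, C, hC, hCi, rfl⟩ := hB
      have hij : i = j := by
        by_contra hij
        exact hconn.isPreconnected.infinite_of_nontrivial hnt
          ((S.interFin i j hij).subset (subset_inter inter_subset_left hBj))
      subst hij
      obtain ⟨J, hJ⟩ := S.markov i
      obtain ⟨k, hk, hCk⟩ := S.exists_mem_subset_A hC (hCi.trans hJ.subset)
      obtain ⟨D, hD, hCD, hDk⟩ := ih hC hCk
      refine ⟨_, ⟨i, D, hD, ?_, rfl⟩, inter_subset_inter_right _ (preimage_mono hCD),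
        inter_subset_left⟩
      rw [hJ]
      exact hDk.trans (subset_biUnion_of_mem (u := S.A) hk)

lemma exists_level_superset {n : ℕ} {B : Set X} (hB : B ∈ level S (n + 1)) :
    ∃ C ∈ level S n, B ⊆ C := by
  obtain ⟨i, hi⟩ := S.exists_subset_A_of_mem_level hB
  obtain ⟨C, hC, hBC, -⟩ := S.exists_level_between hB hi
  exact ⟨C, hC, hBC⟩

/-- König's lemma for the tree of level pieces. -/
lemma exists_nested_of_forall_exists {P : Set X → Prop}
    (hP : ∀ B C, B ⊆ C → P B → P C) (h : ∀ n, ∃ B ∈ level S n, P B) :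
    ∃ A : ℕ → Set X, (∀ n, A n ∈ level S n) ∧ (∀ n, A (n + 1) ⊆ A n) ∧ ∀ n, P (A n) := by
  let T : ℕ → Type _ := fun n => {B : Set X // B ∈ level S n ∧ P B}
  have hpar : ∀ n (B : T (n + 1)), ∃ C : T n, B.1 ⊆ C.1 := fun n B => by
    obtain ⟨C, hC, hBC⟩ := S.exists_level_superset B.2.1
    exact ⟨⟨C, hC, hP _ _ hBC B.2.2⟩, hBC⟩
  choose g hg using hpar
  let F : CategoryTheory.Functor ℕᵒᵖ (Type _) := CategoryTheory.Functor.ofOpSequence (X := T) (fun n => TypeCat.ofHom (g n))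
  have hfin : ∀ k, Finite (F.obj k) := fun k =>
    ((S.finite_level k.unop).subset fun B hB => hB.1 :
      {B : Set X | B ∈ level S k.unop ∧ P B}.Finite).to_subtype
  have hne : ∀ k, Nonempty (F.obj k) := fun k => by
    obtain ⟨B, hB, hPB⟩ := h k.unop
    exact ⟨⟨B, hB, hPB⟩⟩
  obtain ⟨s, hs⟩ := nonempty_sections_of_finite_cofiltered_system F
  let t : ∀ n, T n := fun n => s (Opposite.op n)
  refine ⟨fun n => (t n).1, fun n => (t n).2.1, fun n => ?_, fun n => (t n).2.2⟩
  have hn : g n (t (n + 1)) = t n := by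
    have := hs (CategoryTheory.homOfLE (Nat.le_add_right n 1)).op
    rw [CategoryTheory.Functor.ofOpSequence_map_homOfLE_succ] at this
    exact this
  exact (hg n (t (n + 1))).trans (congrArg Subtype.val hn).subset

end T1

lemma eq_of_mem_nested_of_topExpanding [T2Space X] (hS : TopExpanding S) {A : ℕ → Set X}
    (hA : ∀ n, A n ∈ level S n) {x y : X} (hx : ∀ n, x ∈ A n) (hy : ∀ n, y ∈ A n) : x = y := by
  by_contra hxy
  obtain ⟨U, V, hU, hV, hxU, hyV, hUV⟩ := t2_separation hxy
  obtain ⟨n, -, hn⟩ := (hS x).mem_iff.1 (hU.mem_nhds hxU)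
  have hfin : (⋃ B ∈ {B | B ∈ level S n ∧ x ∉ B}, A n ∩ B).Finite :=
    ((S.finite_level n).subset fun B hB => hB.1).biUnion fun B hB =>
      S.finite_inter_of_mem_level (hA n) hB.1 fun h => hB.2 (h ▸ hx n)
  set E := ⋃ B ∈ {B | B ∈ level S n ∧ x ∉ B}, A n ∩ B
  have hacc := (S.isConnected_of_mem_level (hA n)).isPreconnected.preperfect_of_nontrivial
    ⟨x, hx n, y, hy n, hxy⟩ y (hy n)
  have hnhds : V ∩ (E \ {y})ᶜ ∈ 𝓝 y :=
    (hV.inter (hfin.subset sdiff_subset).isClosed.isOpen_compl).mem_nhds ⟨hyV, fun h => h.2 rfl⟩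
  obtain ⟨z, ⟨⟨hzV, hzE⟩, hzA⟩, hzy⟩ := accPt_iff_nhds.1 hacc _ hnhds
  refine hUV.le_bot ⟨hn (S.mem_interior_star fun B hB hzB => ?_), hzV⟩
  by_contra hxB
  exact hzE ⟨mem_iUnion₂.2 ⟨B, ⟨hB, hxB⟩, hzA, hzB⟩, hzy⟩

lemma topExpanding_of_nested [CompactSpace X] [T1Space X]
    (h : ∀ A : ℕ → Set X, (∀ n, A n ∈ level S n) → (∀ n, A (n + 1) ⊆ A n) →
      ∃ x : X, (⋂ n, A n) = {x}) : TopExpanding S := by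
  refine fun x => ⟨fun t => ⟨fun ht => ?_, fun ⟨n, _, hn⟩ => ?_⟩⟩
  · obtain ⟨V, hVt, hV, hxV⟩ := mem_nhds_iff.1 ht
    by_contra! hcon
    obtain ⟨A, hA, hmono, hAV⟩ := S.exists_nested_of_forall_exists
      (P := fun B => x ∈ B ∧ ¬ B ⊆ V)
      (fun B C hBC hB => ⟨hBC hB.1, fun hCV => hB.2 (hBC.trans hCV)⟩) fun n => by
        by_contra! hn
        exact hcon n trivial (interior_subset.trans
          ((sUnion_subset fun B hB => hn B hB.1 hB.2).trans hVt))
    obtain ⟨y, hy⟩ := h A hA hmono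
    have hxy : x ∈ ⋂ n, A n := mem_iInter.2 fun n => (hAV n).1
    rw [hy, mem_singleton_iff] at hxy
    subst hxy
    obtain ⟨n, hn⟩ := exists_subset_nhds_of_compactSpace
      (antitone_nat_of_succ_le hmono).directed_ge
      (fun n => S.isClosed_of_mem_level (hA n)) (U := V) fun z hz => by
        rw [hy, mem_singleton_iff] at hz
        exact hz ▸ hV.mem_nhds hxV
    exact (hAV n).2 hn
  · exact mem_of_superset
      (isOpen_interior.mem_nhds (S.mem_interior_star fun _ _ hxB => hxB)) hn

end MarkovSystem

/-- Suppose that there is an `N` such that every point of `X` lies in at most `N` pieces of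
each level-`n` partition. Then the Markov map `ℱ` is topologically expanding if and only if
every decreasing sequence of level-`n` pieces has a singleton intersection. -/
theorem top_expanding_iff_nested_singleton
    {X : Type*} [TopologicalSpace X] [CompactSpace X] [TopologicalSpace.MetrizableSpace X]
    {m : ℕ} (S : MarkovSystem X m) (N : ℕ)
    (hN : ∀ (n : ℕ) (x : X), {B | B ∈ level S n ∧ x ∈ B}.Finite ∧
      ({B | B ∈ level S n ∧ x ∈ B}).ncard ≤ N) :
    TopExpanding S ↔
      ∀ A : ℕ → Set X, (∀ n, A n ∈ level S n) → (∀ n, A (n + 1) ⊆ A n) →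
        ∃ x : X, (⋂ n, A n) = {x} := by
  refine ⟨fun hS A hA hmono => ?_, S.topExpanding_of_nested⟩
  obtain ⟨x, hx⟩ := S.nested_nonempty hA hmono
  refine ⟨x, Subset.antisymm (fun y hy => ?_) (singleton_subset_iff.2 hx)⟩
  exact S.eq_of_mem_nested_of_topExpanding hS hA (mem_iInter.1 hy) (mem_iInter.1 hx)
end
end

section
/- Let N ≥ 2 and let (c_i)_{i=1}^N be a sequence with each c_i ∈ {red, blue} such that at least one c_i is red. Then there exist points s₁, …, s_N ∈ ℝ/ℤ, in positive cyclic order, such that each s_i has color c_i and the closed arcs [s_i, s_{i+1}] (indices mod N) are generalized dyadic intervals whose union is ℝ/ℤ, with consecutive arcs meeting only at shared endpoints. -/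
noncomputable section

open Set

/-- The circle `ℝ/ℤ`. -/
abbrev 𝕊 : Type := AddCircle (1 : ℝ)

/-- The natural projection from `ℝ` to the circle `ℝ/ℤ`. -/
def tc (x : ℝ) : 𝕊 := (x : 𝕊)

/-- The closed arc on the circle from `a` to `b`, traversed in the positive direction;
arcs are parametrized by real lifts `a ≤ b ≤ a + 1` of their endpoints. -/
def cArc (a b : ℝ) : Set 𝕊 := tc '' Set.Icc a b

/-- The open arc on the circle from `a` to `b` (the interior of `cArc a b`). -/
def oArc (a b : ℝ) : Set 𝕊 := tc '' Set.Ioo a b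

/-- The multiplication-by-`d` map `σ_d : ℝ/ℤ → ℝ/ℤ`, `σ_d t = d·t`. -/
def sigmaC (d : ℕ) (x : 𝕊) : 𝕊 := d • x

/-- The four model arcs `(0,1)`, `(0,2/3)`, `(1/3,2/3)`, `(1/3,1)` of generalized dyadic
intervals, given by the pairs of endpoints. -/
def gdTypes : Set (ℝ × ℝ) :=
  {(0, 1), (0, 2/3), (1/3, 2/3), (1/3, 1)}

/-- The arc `[a,b]` is a generalized dyadic interval of type `J`: for some `m ≥ 0`, the map
`σ₂^m` restricts to a homeomorphism from the open arc `(a,b)` onto the open model arc `J`. -/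
def IsGenDyadicWith (a b : ℝ) (J : ℝ × ℝ) : Prop :=
  a < b ∧ b ≤ a + 1 ∧ J ∈ gdTypes ∧
    ∃ m : ℕ, ∃ e : ↥(oArc a b) ≃ₜ ↥(oArc J.1 J.2),
      ∀ x : ↥(oArc a b), (e x : 𝕊) = (sigmaC 2)^[m] ↑x

/-- The arc `[a,b]` is a generalized dyadic interval. -/
def IsGenDyadic (a b : ℝ) : Prop := ∃ J, IsGenDyadicWith a b J

/-- A point of the circle is colored red if some iterate of the doubling map sends it
to `0`. -/
def RedG (x : 𝕊) : Prop := ∃ k : ℕ, (sigmaC 2)^[k] x = 0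

/-- A point of the circle is colored blue if some iterate of the doubling map sends it to
`1/3` or `2/3`. -/
def BlueG (x : 𝕊) : Prop :=
  ∃ k : ℕ, (sigmaC 2)^[k] x = tc (1/3) ∨ (sigmaC 2)^[k] x = tc (2/3)

/-- The two colors. -/
inductive GColor : Type
  | red : GColor
  | blue : GColor

/-- A point of the circle has a given color. -/
def HasGColor : GColor → 𝕊 → Prop
  | GColor.red => RedG
  | GColor.blue => BlueG

theorem sigmaC_two_iterate_tc (m : ℕ) (x : ℝ) :
    (sigmaC 2)^[m] (tc x) = tc (2 ^ m * x) := by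
  induction m with
  | zero => simp
  | succ m ih =>
    rw [Function.iterate_succ_apply', ih]
    simp only [sigmaC, tc]
    rw [← AddCircle.coe_nsmul, nsmul_eq_mul]
    congr 1
    push_cast
    ring

theorem tc_add_intCast (x : ℝ) (k : ℤ) : tc (x + k) = tc x := by
  have hk : tc k = 0 := AddCircle.coe_eq_zero_iff 1 |>.2 ⟨k, by simp⟩
  calc tc (x + k) = tc x + tc k := AddCircle.coe_add 1 x k
    _ = tc x := by rw [hk, add_zero]

theorem tc_surjective : Function.Surjective tc := QuotientAddGroup.mk_surjective

theorem continuous_tc : Continuous tc := continuous_quotient_mk'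

theorem isOpenMap_tc : IsOpenMap tc := QuotientAddGroup.isOpenMap_coe

theorem isOpen_oArc (a b : ℝ) : IsOpen (oArc a b) := isOpenMap_tc _ isOpen_Ioo

theorem tc_injOn_Ioo {a b : ℝ} (h : b ≤ a + 1) : InjOn tc (Ioo a b) := by
  have hsub : Ioo a b ⊆ Ico a (a + 1) := fun x hx => ⟨hx.1.le, hx.2.trans_le h⟩
  exact fun x hx y hy hxy => (AddCircle.coe_eq_coe_iff_of_mem_Ico (hsub hx) (hsub hy)).1 hxy

theorem isOpenMap_sigmaC_two_iterate (m : ℕ) : IsOpenMap (sigmaC 2)^[m] := by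
  have h : (sigmaC 2)^[m] ∘ tc = tc ∘ fun x : ℝ => 2 ^ m * x :=
    funext (sigmaC_two_iterate_tc m)
  refine .of_comp continuous_tc tc_surjective ?_
  rw [h]
  exact isOpenMap_tc.comp (Homeomorph.mulLeft₀ ((2 : ℝ) ^ m) (by positivity)).isOpenMap

theorem continuous_sigmaC_two_iterate (m : ℕ) : Continuous (sigmaC 2)^[m] :=
  (continuous_nsmul 2).iterate m

/-- An arc is generalized dyadic as soon as multiplication by `2 ^ m` carries it onto an
integer translate of one of the model arcs. -/
theorem IsGenDyadic.of_mul_eq {a b : ℝ} {J : ℝ × ℝ} (hJ : J ∈ gdTypes) (m : ℕ) (k : ℤ)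
    (ha : 2 ^ m * a = J.1 + k) (hb : 2 ^ m * b = J.2 + k) : IsGenDyadic a b := by
  have hJ₁ : J.1 < J.2 ∧ J.2 ≤ J.1 + 1 := by
    rcases hJ with rfl | rfl | rfl | rfl <;> norm_num
  have h2 : (0 : ℝ) < 2 ^ m := by positivity
  have h1 : (1 : ℝ) ≤ 2 ^ m := one_le_pow₀ (by norm_num)
  have hab : a < b := lt_of_mul_lt_mul_left (by linarith) h2.le
  have hba : b ≤ a + 1 := le_of_mul_le_mul_left (by linarith) h2
  have hmem (x : ℝ) (hx : x ∈ Ioo a b) : 2 ^ m * x - k ∈ Ioo J.1 J.2 := by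
    have hx₁ := mul_lt_mul_of_pos_left hx.1 h2
    have hx₂ := mul_lt_mul_of_pos_left hx.2 h2
    constructor <;> linarith
  have hval (x : ℝ) : (sigmaC 2)^[m] (tc x) = tc (2 ^ m * x - k) := by
    rw [sigmaC_two_iterate_tc, ← tc_add_intCast (2 ^ m * x - k) k, sub_add_cancel]
  have hmaps : MapsTo (sigmaC 2)^[m] (oArc a b) (oArc J.1 J.2) := by
    rintro _ ⟨x, hx, rfl⟩
    exact ⟨_, hmem x hx, (hval x).symm⟩
  have hinj : InjOn (sigmaC 2)^[m] (oArc a b) := by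
    rintro _ ⟨x, hx, rfl⟩ _ ⟨y, hy, rfl⟩ hxy
    rw [hval, hval] at hxy
    have := tc_injOn_Ioo hJ₁.2 (hmem x hx) (hmem y hy) hxy
    rw [mul_left_cancel₀ h2.ne' (by linarith : 2 ^ m * x = 2 ^ m * y)]
  have hsurj : SurjOn (sigmaC 2)^[m] (oArc a b) (oArc J.1 J.2) := by
    rintro _ ⟨y, hy, rfl⟩
    have hy' : 2 ^ m * ((y + k) / 2 ^ m) = y + k := by field_simp
    refine ⟨_, ⟨(y + k) / 2 ^ m, ⟨?_, ?_⟩, rfl⟩, ?_⟩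
    · exact lt_of_mul_lt_mul_left (by linarith [hy.1]) h2.le
    · exact lt_of_mul_lt_mul_left (by linarith [hy.2]) h2.le
    · rw [hval, hy', add_sub_cancel_right]
  refine ⟨J, hab, hba, hJ, m,
    (Equiv.ofBijective (hmaps.restrict _ _ _)
      ⟨hmaps.restrict_inj.2 hinj, hmaps.restrict_surjective_iff.2 hsurj⟩).toHomeomorphOfContinuousOpen
      ((continuous_sigmaC_two_iterate m).restrict hmaps) ?_, fun x => rfl⟩
  exact ((isOpenMap_sigmaC_two_iterate m).comp (isOpen_oArc a b).isOpenMap_subtype_val).subtype_mk _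

/-- The weight of a color: the points `z - c.weight / 2 ^ n` have color `c`. -/
def GColor.weight : GColor → ℝ
  | GColor.red => 1
  | GColor.blue => 2 / 3

theorem hasGColor_tc_sub_weight (c : GColor) (z : ℤ) (n : ℕ) :
    HasGColor c (tc (z - c.weight / 2 ^ n)) := by
  cases c with
  | red =>
    refine ⟨n, ?_⟩
    rw [sigmaC_two_iterate_tc, show (2 : ℝ) ^ n * (z - GColor.red.weight / 2 ^ n)
      = 0 + (2 ^ n * z - 1 : ℤ) by simp only [GColor.weight]; push_cast; field_simp; ring,
      tc_add_intCast]
    rfl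
  | blue =>
    refine ⟨n, Or.inl ?_⟩
    rw [sigmaC_two_iterate_tc, show (2 : ℝ) ^ n * (z - GColor.blue.weight / 2 ^ n)
      = 1 / 3 + (2 ^ n * z - 1 : ℤ) by simp only [GColor.weight]; push_cast; field_simp; ring,
      tc_add_intCast]

theorem isGenDyadic_sub_weight (c d : GColor) (z : ℤ) (n : ℕ) :
    IsGenDyadic (z - c.weight / 2 ^ n) (z - d.weight / 2 ^ (n + 1)) := by
  cases c <;> cases d
  · refine .of_mul_eq (J := (0, 1)) (by simp [gdTypes]) (n + 1) (2 ^ (n + 1) * z - 2) ?_ ?_ <;>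
      (simp only [GColor.weight, pow_succ]; push_cast; field_simp; ring)
  · refine .of_mul_eq (J := (0, 2 / 3)) (by simp [gdTypes]) n (2 ^ n * z - 1) ?_ ?_ <;>
      (simp only [GColor.weight, pow_succ]; push_cast; field_simp; ring)
  · refine .of_mul_eq (J := (1 / 3, 1)) (by simp [gdTypes]) (n + 2) (2 ^ (n + 2) * z - 3) ?_ ?_ <;>
      (simp only [GColor.weight, pow_succ]; push_cast; field_simp; ring)
  · refine .of_mul_eq (J := (1 / 3, 2 / 3)) (by simp [gdTypes]) n (2 ^ n * z - 1) ?_ ?_ <;>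
      (simp only [GColor.weight, pow_succ]; push_cast; field_simp; ring)

theorem isGenDyadic_sub_weight_intCast (c : GColor) (z : ℤ) (n : ℕ) :
    IsGenDyadic (z - c.weight / 2 ^ n) z := by
  cases c
  · refine .of_mul_eq (J := (0, 1)) (by simp [gdTypes]) n (2 ^ n * z - 1) ?_ ?_ <;>
      (simp only [GColor.weight]; push_cast; field_simp; ring)
  · refine .of_mul_eq (J := (1 / 3, 1)) (by simp [gdTypes]) n (2 ^ n * z - 1) ?_ ?_ <;>
      (simp only [GColor.weight]; push_cast; field_simp; ring)

theorem exists_mem_Icc_succ_of_mem_Ico (s : ℕ → ℝ) (y : ℝ) (n : ℕ) (hy : y ∈ Ico (s 0) (s n)) :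
    ∃ i < n, y ∈ Icc (s i) (s (i + 1)) := by
  induction n with
  | zero => exact absurd hy.2 (not_lt.2 hy.1)
  | succ n ih =>
    rcases lt_or_ge y (s n) with h | h
    · obtain ⟨i, hi, hyi⟩ := ih ⟨hy.1, h⟩
      exact ⟨i, by omega, hyi⟩
    · exact ⟨n, by omega, h, hy.2.le⟩

theorem biUnion_cArc_eq_univ {s : ℕ → ℝ} {N : ℕ} (h : s N = s 0 + 1) :
    (⋃ i ∈ Finset.range N, cArc (s i) (s (i + 1))) = Set.univ := by
  refine eq_univ_of_forall fun x => ?_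
  obtain ⟨y, hy, rfl⟩ : x ∈ tc '' Ico (s 0) (s 0 + 1) := by
    rw [show tc '' Ico (s 0) (s 0 + 1) = univ from AddCircle.coe_image_Ico_eq 1 (s 0)]
    trivial
  obtain ⟨i, hi, hyi⟩ := exists_mem_Icc_succ_of_mem_Ico s y N (h ▸ hy)
  exact mem_biUnion (Finset.mem_coe.2 (Finset.mem_range.2 hi)) ⟨y, hyi, rfl⟩

/-- Given `N ≥ 2` colors `c₁, …, c_N ∈ {red, blue}`, at least one of which is red, there are
points `s₁, …, s_N` of `ℝ/ℤ` in positive cyclic order such that each `s_i` has color `c_i`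
and the closed arcs `[s_i, s_{i+1}]` (indices mod `N`) are generalized dyadic intervals
whose union is `ℝ/ℤ`, consecutive arcs meeting only at shared endpoints. -/
theorem genDyadic_circle_decomposition (N : ℕ) (hN : 2 ≤ N) (c : ℕ → GColor)
    (hred : ∃ i < N, c i = GColor.red) :
    ∃ s : ℕ → ℝ, s N = s 0 + 1 ∧
      (∀ i < N, IsGenDyadic (s i) (s (i + 1))) ∧
      (∀ i < N, HasGColor (c i) (tc (s i))) ∧
      (⋃ i ∈ Finset.range N, cArc (s i) (s (i + 1))) = Set.univ := by
  obtain ⟨r, hrN, hr⟩ := hred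
  let t : ℕ → ℝ := fun i => if i < r then ((0 : ℤ) : ℝ) - (c i).weight / 2 ^ (i + N - r)
    else ((1 : ℤ) : ℝ) - (c i).weight / 2 ^ (i - r)
  have ht₁ {i : ℕ} (h : i < r) : t i = ((0 : ℤ) : ℝ) - (c i).weight / 2 ^ (i + N - r) := if_pos h
  have ht₂ {i : ℕ} (h : r ≤ i) : t i = ((1 : ℤ) : ℝ) - (c i).weight / 2 ^ (i - r) :=
    if_neg h.not_gt
  have htr : t r = ((0 : ℤ) : ℝ) := by rw [ht₂ le_rfl]; simp [hr, GColor.weight]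
  let s : ℕ → ℝ := fun i => if i < N then t i else t 0 + 1
  have hs₁ {i : ℕ} (h : i < N) : s i = t i := if_pos h
  have hsN : s N = t 0 + 1 := if_neg (lt_irrefl N)
  have hper : s N = s 0 + 1 := by rw [hsN, hs₁ (by omega)]
  refine ⟨s, hper, fun i hi => ?_, fun i hi => ?_, biUnion_cArc_eq_univ hper⟩
  · rcases lt_trichotomy (i + 1) N with hiN | hiN | hiN
    · rw [hs₁ hi, hs₁ hiN]
      rcases lt_trichotomy (i + 1) r with h | h | h
      · rw [ht₁ (by omega), ht₁ h, show i + 1 + N - r = i + N - r + 1 by omega]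
        exact isGenDyadic_sub_weight ..
      · rw [h, htr, ht₁ (by omega)]
        exact isGenDyadic_sub_weight_intCast ..
      · rw [ht₂ (by omega), ht₂ h.le, show i + 1 - r = i - r + 1 by omega]
        exact isGenDyadic_sub_weight ..
    · rw [hiN, hsN, hs₁ hi, ht₂ (by omega)]
      rcases Nat.eq_zero_or_pos r with h | h
      · rw [show t 0 + 1 = ((1 : ℤ) : ℝ) by rw [← h, htr]; simp]
        exact isGenDyadic_sub_weight_intCast ..
      · rw [ht₁ h, show 0 + N - r = i - r + 1 by omega, show ((0 : ℤ) : ℝ)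
          - (c 0).weight / 2 ^ (i - r + 1) + 1
            = ((1 : ℤ) : ℝ) - (c 0).weight / 2 ^ (i - r + 1) by push_cast; ring]
        exact isGenDyadic_sub_weight ..
    · omega
  · rw [hs₁ hi]
    rcases lt_or_ge i r with h | h
    · rw [ht₁ h]
      exact hasGColor_tc_sub_weight ..
    · rw [ht₂ h]
      exact hasGColor_tc_sub_weight ..
end
end
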